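/- Let 𝒜 be a convex subset of 𝔗₁(ℋ) (positive trace-class operators with trace ≤ 1) on which the quantum entropy H is bounded. Then there exists an operator T ∈ 𝔗₁(ℋ) such that sup_{A ∈ 𝒜} Tr A(−log T) < +∞, and such that U T = T U holds for every unitary operator U on ℋ with the property that U A U* ∈ 𝒜 for all A ∈ 𝒜. -/

import Mathlib

open scoped ENNReal NNReal
open Filter Topology Classical
attribute [local instance] Classical.propDecidable

noncomputable section

namespace QIT

section Defs

variable {E F G : Type*}
variable [NormedAddCommGroup E] [InnerProductSpace ℂ E] [CompleteSpace E]
variable [NormedAddCommGroup F] [InnerProductSpace ℂ F] [CompleteSpace F]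
variable [NormedAddCommGroup G] [InnerProductSpace ℂ G] [CompleteSpace G]

/-- The real part of `⟪x, A x⟫`. -/
def qf (A : E →L[ℂ] E) (x : E) : ℝ := (inner ℂ x (A x) : ℂ).re

/-- The trace of a positive operator, as the supremum of finite diagonal sums over
finite orthonormal families.  For positive operators this coincides with the usual
trace (with value `∞` when the operator is not trace class). -/
def traceENN (A : E →L[ℂ] E) : ℝ≥0∞ :=
  ⨆ (n : ℕ) (e : Fin n → E) (_ : Orthonormal ℂ e), ∑ i, ENNReal.ofReal (qf A (e i))

/-- The trace norm `‖A‖₁`, as the supremum of `∑ |⟪e i, A (f i)⟫|` over pairs of finite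
orthonormal families; it is finite exactly on trace-class operators. -/
def traceNorm (A : E →L[ℂ] E) : ℝ≥0∞ :=
  ⨆ (n : ℕ) (e : Fin n → E) (f : Fin n → E) (_ : Orthonormal ℂ e) (_ : Orthonormal ℂ f),
    ∑ i, ENNReal.ofReal ‖(inner ℂ (e i) (A (f i)) : ℂ)‖

/-- `A` is a trace-class operator. -/
def IsTC (A : E →L[ℂ] E) : Prop := traceNorm A ≠ ∞

/-- The cone `𝔗₊(E)` of positive trace-class operators. -/
def posTC (E : Type*) [NormedAddCommGroup E] [InnerProductSpace ℂ E] [CompleteSpace E] :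
    Set (E →L[ℂ] E) := {A | A.IsPositive ∧ IsTC A}

/-- The set `𝔖(E)` of states (density operators). -/
def states (E : Type*) [NormedAddCommGroup E] [InnerProductSpace ℂ E] [CompleteSpace E] :
    Set (E →L[ℂ] E) := {A | A.IsPositive ∧ traceENN A = 1}

/-- The extended classical entropy `H({x_i}) = ∑ η(x_i) − η(∑ x_i)` of a nonnegative
summable family, written in the equivalent homogeneous form `(∑ x) · H({x_i/∑x})`. -/
def clEntropy {ι : Type*} (x : ι → ℝ) : ℝ≥0∞ :=
  ENNReal.ofReal (∑' i, x i) *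
    ∑' i, ENNReal.ofReal (Real.negMulLog (x i / (∑' j, x j)))

/-- An orthonormal subset with dense span (an orthonormal basis, as a set). -/
def IsONB (s : Set E) : Prop :=
  Orthonormal ℂ ((↑) : s → E) ∧ Dense ((Submodule.span ℂ s : Submodule ℂ E) : Set E)

/-- The quantum (von Neumann) entropy `H(A) = Tr η(A) − η(Tr A)` of a positive trace-class
operator, realized as the infimum over all orthonormal bases of the classical entropy of
the diagonal of `A` (the infimum is attained on an eigenbasis of `A`). -/
def qEntropy (A : E →L[ℂ] E) : ℝ≥0∞ :=
  ⨅ (s : Set E) (_ : IsONB s), clEntropy fun v : s => qf A v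

theorem exists_isONB (E : Type*) [NormedAddCommGroup E] [InnerProductSpace ℂ E]
    [CompleteSpace E] : ∃ s : Set E, IsONB s := by
  obtain ⟨w, b, hb⟩ := exists_hilbertBasis ℂ E
  refine ⟨w, ?_, ?_⟩
  · have h := b.orthonormal
    rwa [hb] at h
  · have h := b.dense_span
    rw [hb, Subtype.range_coe] at h
    rwa [Submodule.dense_iff_topologicalClosure_eq_top]

/-- A fixed orthonormal basis (as a set). -/
def stdONB (E : Type*) [NormedAddCommGroup E] [InnerProductSpace ℂ E] [CompleteSpace E] :
    Set E := (exists_isONB E).choose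

/-- The `ℂ`-valued trace, computed in a fixed orthonormal basis; for trace-class
operators it does not depend on the choice of the basis. -/
def traceC (A : E →L[ℂ] E) : ℂ := ∑' v : stdONB E, (inner ℂ (v : E) (A v) : ℂ)

/-- Continuity (including finiteness) of an `ℝ≥0∞`-valued function on a subset of
operators, with respect to the trace-norm distance. -/
def ContOn (f : (E →L[ℂ] E) → ℝ≥0∞) (𝒜 : Set (E →L[ℂ] E)) : Prop :=
  (∀ A ∈ 𝒜, f A ≠ ∞) ∧
  ∀ A ∈ 𝒜, ∀ ε : ℝ, 0 < ε → ∃ δ : ℝ, 0 < δ ∧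
    ∀ B ∈ 𝒜, traceNorm (B - A) < ENNReal.ofReal δ → |(f B).toReal - (f A).toReal| < ε

/-- Continuity of a real-valued function on a subset of operators with respect to the
trace-norm distance. -/
def RContOn (g : (E →L[ℂ] E) → ℝ) (𝒜 : Set (E →L[ℂ] E)) : Prop :=
  ∀ A ∈ 𝒜, ∀ ε : ℝ, 0 < ε → ∃ δ : ℝ, 0 < δ ∧
    ∀ B ∈ 𝒜, traceNorm (B - A) < ENNReal.ofReal δ → |g B - g A| < ε

/-- Boundedness of an `ℝ≥0∞`-valued function on a set. -/
def BddOn (f : (E →L[ℂ] E) → ℝ≥0∞) (𝒜 : Set (E →L[ℂ] E)) : Prop :=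
  ∃ C : ℝ, ∀ A ∈ 𝒜, f A ≤ ENNReal.ofReal C

/-- Convergence of a sequence of operators in the trace norm. -/
def TendstoTN (A : ℕ → (E →L[ℂ] E)) (A₀ : E →L[ℂ] E) : Prop :=
  ∀ ε : ℝ, 0 < ε → ∃ N : ℕ, ∀ n ≥ N, traceNorm (A n - A₀) < ENNReal.ofReal ε

/-- A positive linear map from the trace class of `E` to the trace class of `F`
(the values of `toFun` outside the trace class are irrelevant). -/
structure TraceMap (E F : Type*) [NormedAddCommGroup E] [InnerProductSpace ℂ E]
    [CompleteSpace E] [NormedAddCommGroup F] [InnerProductSpace ℂ F] [CompleteSpace F] where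
  toFun : (E →L[ℂ] E) → (F →L[ℂ] F)
  map_add : ∀ A B, IsTC A → IsTC B → toFun (A + B) = toFun A + toFun B
  map_smul : ∀ (c : ℂ) A, IsTC A → toFun (c • A) = c • toFun A
  maps_tc : ∀ A, IsTC A → IsTC (toFun A)
  pos : ∀ A, IsTC A → A.IsPositive → (toFun A).IsPositive

/-- A trace-non-increasing map. -/
def TraceMap.TNI (Φ : TraceMap E F) : Prop :=
  ∀ A, IsTC A → A.IsPositive → traceENN (Φ.toFun A) ≤ traceENN A

/-- A trace-preserving map. -/
def TraceMap.TP (Φ : TraceMap E F) : Prop :=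
  ∀ A, IsTC A → A.IsPositive → traceENN (Φ.toFun A) = traceENN A

/-- A map bounded with respect to the trace norm. -/
def TraceMap.Bounded (Φ : TraceMap E F) : Prop :=
  ∃ C : ℝ≥0, ∀ A, traceNorm (Φ.toFun A) ≤ (C : ℝ≥0∞) * traceNorm A

/-- The output entropy `H_Φ = H ∘ Φ`. -/
def outEntropy (Φ : TraceMap E F) (A : E →L[ℂ] E) : ℝ≥0∞ := qEntropy (Φ.toFun A)

/-- The rank-one operator `|x⟩⟨x|`. -/
def rankOne (x : E) : E →L[ℂ] E := (innerSL ℂ x).smulRight x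

/-- The rank-one operator `|x⟩⟨y|`. -/
def rankOneM (x y : E) : E →L[ℂ] E := (innerSL ℂ y).smulRight x

end Defs

section Defs2

variable {E F G : Type*}
variable [NormedAddCommGroup E] [InnerProductSpace ℂ E] [CompleteSpace E]
variable [NormedAddCommGroup F] [InnerProductSpace ℂ F] [CompleteSpace F]
variable [NormedAddCommGroup G] [InnerProductSpace ℂ G] [CompleteSpace G]

/-- The completely positive map `A ↦ ∑ᵢ Vᵢ A Vᵢ*` defined by a sequence of Kraus
operators. -/
def krausMap (V : ℕ → (E →L[ℂ] F)) (A : E →L[ℂ] E) : F →L[ℂ] F :=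
  ∑' i, V i ∘L A ∘L ContinuousLinearMap.adjoint (V i)

/-- The Kraus condition `∑ᵢ Vᵢ* Vᵢ ≤ I` (all partial sums are dominated by `I`). -/
def KrausTNI (V : ℕ → (E →L[ℂ] F)) : Prop :=
  ∀ n : ℕ,
    ((1 : E →L[ℂ] E) - ∑ i ∈ Finset.range n, ContinuousLinearMap.adjoint (V i) ∘L V i).IsPositive

/-- The Kraus condition `∑ᵢ Vᵢ* Vᵢ = I` (strong convergence), i.e. trace preservation. -/
def KrausTP (V : ℕ → (E →L[ℂ] F)) : Prop :=
  ∀ x : E, HasSum (fun i => (ContinuousLinearMap.adjoint (V i)) (V i x)) x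

/-- `(Φ, Φt)` is a complementary pair of quantum operations: for some Kraus
representation `Φ(·) = ∑ᵢ Vᵢ (·) Vᵢ*` and some orthonormal basis `{bᵢ}` of `G`,
`Φt(A) = ∑_{i,j} Tr[Vᵢ A Vⱼ*] |bᵢ⟩⟨bⱼ|` (characterized by its matrix entries). -/
def IsComplementaryPair (Φ : TraceMap E F) (Φt : TraceMap E G) : Prop :=
  ∃ (V : ℕ → (E →L[ℂ] F)) (b : HilbertBasis ℕ ℂ G),
    KrausTNI V ∧
    (∀ A, IsTC A → Φ.toFun A = krausMap V A) ∧
    (∀ A, IsTC A → ∀ i j : ℕ,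
      (inner ℂ (b i) (Φt.toFun A (b j)) : ℂ) =
        traceC (V i ∘L A ∘L ContinuousLinearMap.adjoint (V j)))

/-- A map (on trace-class operators) preserves continuity of the entropy:
its output entropy is continuous on every subset of the positive trace-class cone on
which the von Neumann entropy is continuous. -/
def PCE (Φf : (E →L[ℂ] E) → (F →L[ℂ] F)) : Prop :=
  ∀ 𝒜 : Set (E →L[ℂ] E), 𝒜 ⊆ posTC E → ContOn qEntropy 𝒜 →
    ContOn (fun A => qEntropy (Φf A)) 𝒜

/-- `μ` is the sequence of nonzero eigenvalues (with multiplicities, possibly padded by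
zeros) of the diagonalizable positive operator `T`, every vector orthogonal to the
eigenvectors being annihilated by `T`. -/
def IsEigenSeq (T : E →L[ℂ] E) (μ : ℕ → ℝ) : Prop :=
  ∃ e : ℕ → E,
    (∀ i j, i ≠ j → (inner ℂ (e i) (e j) : ℂ) = 0) ∧
    (∀ i, (μ i ≠ 0 → ‖e i‖ = 1) ∧ (μ i = 0 → e i = 0)) ∧
    (∀ i, T (e i) = (μ i : ℂ) • e i) ∧
    (∀ x : E, (∀ i, (inner ℂ (e i) x : ℂ) = 0) → T x = 0)

/-- `ν` is the sequence of singular values of `V` (eigenvalues of `√(V*V)`,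
equivalently `ν²` are the eigenvalues of `V*V`). -/
def IsSingularValues (V : E →L[ℂ] F) (ν : ℕ → ℝ) : Prop :=
  (∀ i, 0 ≤ ν i) ∧ IsEigenSeq (ContinuousLinearMap.adjoint V ∘L V) (fun i => ν i ^ 2)

/-- `∑ᵢ e^{−l/νᵢ²}`, the sum being taken over the indices with `νᵢ ≠ 0`. -/
def expSum (ν : ℕ → ℝ) (l : ℝ) : ℝ≥0∞ :=
  ∑' i, if ν i = 0 then 0 else ENNReal.ofReal (Real.exp (-(l / ν i ^ 2)))

/-- `λ*(V) < ∞`: `V` is compact (automatic here) and `∑ᵢ e^{−l/νᵢ²} < ∞` for some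
`l > 0`, where `{νᵢ}` are the singular values of `V`. -/
def LamStarFin (V : E →L[ℂ] F) : Prop :=
  ∃ ν : ℕ → ℝ, IsSingularValues V ν ∧ ∃ l : ℝ, 0 < l ∧ expSum ν l ≠ ∞

/-- `λ*(√S) < ∞` for a positive operator `S` (the singular values of `√S` are the
square roots of the eigenvalues of `S`). -/
def LamStarSqrtFin (S : E →L[ℂ] E) : Prop :=
  ∃ ν : ℕ → ℝ, (∀ i, 0 ≤ ν i) ∧ IsEigenSeq S (fun i => ν i ^ 2) ∧
    ∃ l : ℝ, 0 < l ∧ expSum ν l ≠ ∞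

/-- The value `λ*` associated to a sequence `ν` of singular values: the unique solution
of `∑ᵢ e^{−λ/νᵢ²} = 1` if it exists, and `inf{λ > 0 | ∑ᵢ e^{−λ/νᵢ²} < ∞}` otherwise. -/
def lamStarOf (ν : ℕ → ℝ) : ℝ≥0∞ :=
  if h : ∃ l : ℝ, expSum ν l = 1 then ENNReal.ofReal h.choose
  else ⨅ (l : ℝ) (_ : 0 < l ∧ expSum ν l ≠ ∞), ENNReal.ofReal l

/-- The parameter `λ*(V) ∈ [0,∞]` of a bounded operator `V`. -/
def lamStar (V : E →L[ℂ] F) : ℝ≥0∞ :=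
  if h : ∃ ν : ℕ → ℝ, IsSingularValues V ν then lamStarOf h.choose else ∞

/-- `rank A ≤ k`. -/
def rankLE (A : E →L[ℂ] E) (k : ℕ) : Prop :=
  Module.rank ℂ (LinearMap.range (A : E →ₗ[ℂ] E)) ≤ k

/-- The set `𝔗₊ᵏ(E)` of positive (trace-class) operators of rank at most `k`. -/
def rankCone (E : Type*) [NormedAddCommGroup E] [InnerProductSpace ℂ E] [CompleteSpace E]
    (k : ℕ) : Set (E →L[ℂ] E) := {A | A.IsPositive ∧ rankLE A k}

/-- A decomposition of `A` into a countable convex combination of positive operators of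
rank at most `k`. -/
structure Decomp (k : ℕ) (A : E →L[ℂ] E) where
  π : ℕ → ℝ
  op : ℕ → (E →L[ℂ] E)
  π_nonneg : ∀ i, 0 ≤ π i
  π_sum : HasSum π 1
  op_pos : ∀ i, (op i).IsPositive
  op_rank : ∀ i, rankLE (op i) k
  sum_eq : HasSum (fun i => π i • op i) A

/-- The `k`-order approximator `H_Φᵏ` of the output entropy of `Φ`. -/
def kApprox (Φf : (E →L[ℂ] E) → (F →L[ℂ] F)) (k : ℕ) (A : E →L[ℂ] E) : ℝ≥0∞ :=
  ⨆ d : Decomp k A, ∑' i, ENNReal.ofReal (d.π i) * qEntropy (Φf (d.op i))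

/-- The set of pure states (extreme points of `𝔖(E)`). -/
def pureStates (E : Type*) [NormedAddCommGroup E] [InnerProductSpace ℂ E]
    [CompleteSpace E] : Set (E →L[ℂ] E) := {A | ∃ x : E, ‖x‖ = 1 ∧ A = rankOne x}

end Defs2

section Tensor

variable (E F G : Type*)
variable [NormedAddCommGroup E] [InnerProductSpace ℂ E] [CompleteSpace E]
variable [NormedAddCommGroup F] [InnerProductSpace ℂ F] [CompleteSpace F]
variable [NormedAddCommGroup G] [InnerProductSpace ℂ G] [CompleteSpace G]

/-- A realization of `G` as the Hilbert tensor product `E ⊗ F`, together with the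
tensor product of (bounded) operators. -/
structure TensorData where
  tmul : E → F → G
  add_left : ∀ x y z, tmul (x + y) z = tmul x z + tmul y z
  add_right : ∀ x y z, tmul x (y + z) = tmul x y + tmul x z
  smul_left : ∀ (c : ℂ) x y, tmul (c • x) y = c • tmul x y
  smul_right : ∀ (c : ℂ) x y, tmul x (c • y) = c • tmul x y
  inner_tmul : ∀ x x' y y',
    (inner ℂ (tmul x y) (tmul x' y') : ℂ) = (inner ℂ x x' : ℂ) * (inner ℂ y y' : ℂ)
  dense_span : Dense ((Submodule.span ℂ {z | ∃ x y, z = tmul x y} : Submodule ℂ G) : Set G)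
  omul : (E →L[ℂ] E) → (F →L[ℂ] F) → (G →L[ℂ] G)
  omul_tmul : ∀ A B x y, omul A B (tmul x y) = tmul (A x) (B y)

end Tensor

section NegLog

variable {E : Type*} [NormedAddCommGroup E] [InnerProductSpace ℂ E] [CompleteSpace E]

/-- `Tr A(−log T)` for positive operators `A` and `T` (with `‖T‖ ≤ 1`), realized by
monotone approximation: `Tr A(−log T) = sup_n Tr(A · max(0, −log(T + 1/(n+1)·I)))`. -/
def traceNegLog (A T : E →L[ℂ] E) : ℝ≥0∞ :=
  ⨆ n : ℕ,
    ENNReal.ofReal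
      (traceC (A * cfc (fun x : ℝ => max 0 (-(Real.log (x + 1 / (n + 1 : ℝ))))) T)).re

end NegLog

section HilbertSchmidt

variable {E : Type*} [NormedAddCommGroup E] [InnerProductSpace ℂ E]

theorem tsum_enorm_inner_sq {ι : Type*} (b : HilbertBasis ι ℂ E) (x : E) :
    ∑' i, ‖(inner ℂ (b i) x : ℂ)‖ₑ ^ 2 = ‖x‖ₑ ^ 2 := by
  have h := b.hasSum_inner_mul_inner x x
  have h2 : HasSum (fun i => ‖(inner ℂ (b i) x : ℂ)‖ ^ 2) (‖x‖ ^ 2) := by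
    have h3 := Complex.hasSum_re h
    convert! h3 using 1
    · ext i
      rw [← inner_conj_symm x (b i), RCLike.conj_mul]
      norm_cast
    · rw [inner_self_eq_norm_sq_to_K]; norm_cast
  have h4 := ENNReal.ofReal_tsum_of_nonneg (fun i => sq_nonneg _) h2.summable
  rw [h2.tsum_eq, ENNReal.ofReal_pow (norm_nonneg _), ofReal_norm] at h4
  rw [h4]
  exact tsum_congr fun i => by rw [ENNReal.ofReal_pow (norm_nonneg _), ofReal_norm]

theorem qf_nonneg {A : E →L[ℂ] E} (hA : 0 ≤ A) (x : E) : 0 ≤ qf A x :=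
  ((ContinuousLinearMap.nonneg_iff_isPositive A).1 hA).re_inner_nonneg_right x

theorem qf_mono {A B : E →L[ℂ] E} (h : A ≤ B) (x : E) : qf A x ≤ qf B x := by
  have := ((ContinuousLinearMap.le_def A B).1 h).re_inner_nonneg_right x
  simp only [sub_apply, inner_sub_right, map_sub, sub_nonneg] at this
  exact this

theorem qf_add (A B : E →L[ℂ] E) (x : E) : qf (A + B) x = qf A x + qf B x := by
  simp [qf]

theorem qf_smul (a : ℝ) (A : E →L[ℂ] E) (x : E) : qf (a • A) x = a * qf A x := by
  rw [qf, smul_apply, inner_smul_right_eq_smul, Complex.smul_re]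
  rfl

theorem qf_sum {ι : Type*} (s : Finset ι) (A : ι → E →L[ℂ] E) (x : E) :
    qf (∑ i ∈ s, A i) x = ∑ i ∈ s, qf (A i) x := by
  simp [qf]

variable [CompleteSpace E]

open ContinuousLinearMap (adjoint)

/-- The Hilbert basis determined by an orthonormal set with dense span. -/
def IsONB.hilbertBasis {s : Set E} (hs : IsONB s) : HilbertBasis s ℂ E :=
  HilbertBasis.mk hs.1 (by
    rw [Subtype.range_coe, Submodule.dense_iff_topologicalClosure_eq_top.1 hs.2])

theorem IsONB.hilbertBasis_apply {s : Set E} (hs : IsONB s) (v : s) :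
    hs.hilbertBasis v = (v : E) := by
  simp [IsONB.hilbertBasis]

variable (E) in
/-- The Hilbert basis underlying `stdONB`. -/
def stdBasis : HilbertBasis (stdONB E) ℂ E :=
  IsONB.hilbertBasis (s := stdONB E) (exists_isONB E).choose_spec

theorem stdBasis_apply (v : stdONB E) : stdBasis E v = (v : E) :=
  IsONB.hilbertBasis_apply _ v

/-- The squared Hilbert–Schmidt norm. -/
def hsSq (X : E →L[ℂ] E) : ℝ≥0∞ := ∑' v : stdONB E, ‖X (stdBasis E v)‖ₑ ^ 2

theorem tsum_enorm_adjoint {ι κ : Type*} (b : HilbertBasis ι ℂ E) (c : HilbertBasis κ ℂ E)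
    (X : E →L[ℂ] E) :
    ∑' i, ‖X (b i)‖ₑ ^ 2 = ∑' j, ‖adjoint X (c j)‖ₑ ^ 2 := by
  simp_rw [← tsum_enorm_inner_sq c (X (b _)), ← tsum_enorm_inner_sq b (adjoint X (c _))]
  rw [ENNReal.tsum_comm]
  refine tsum_congr fun j => tsum_congr fun i => ?_
  rw [ContinuousLinearMap.adjoint_inner_right, ← inner_conj_symm, RCLike.enorm_conj]

theorem hsSq_adjoint (X : E →L[ℂ] E) : hsSq (adjoint X) = hsSq X :=
  (tsum_enorm_adjoint _ _ X).symm

theorem hsSq_eq_tsum {ι : Type*} (b : HilbertBasis ι ℂ E) (X : E →L[ℂ] E) :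
    hsSq X = ∑' i, ‖X (b i)‖ₑ ^ 2 := by
  rw [tsum_enorm_adjoint b (stdBasis E) X, ← hsSq_adjoint, hsSq]

theorem qf_eq_norm_sq {A X : E →L[ℂ] E} (h : adjoint X * X = A) (x : E) :
    qf A x = ‖X x‖ ^ 2 := by
  rw [qf, ← h, mul_apply_eq_comp, ContinuousLinearMap.adjoint_inner_right,
    inner_self_eq_norm_sq_to_K]
  norm_cast

theorem ofReal_qf_eq {A X : E →L[ℂ] E} (h : adjoint X * X = A) (x : E) :
    ENNReal.ofReal (qf A x) = ‖X x‖ₑ ^ 2 := by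
  rw [qf_eq_norm_sq h, ENNReal.ofReal_pow (norm_nonneg _), ofReal_norm]

theorem adjoint_sqrt (A : E →L[ℂ] E) : adjoint (CFC.sqrt A) = CFC.sqrt A :=
  (IsSelfAdjoint.of_nonneg (CFC.sqrt_nonneg A)).star_eq

theorem adjoint_sqrt_mul_sqrt {A : E →L[ℂ] E} (hA : 0 ≤ A) :
    adjoint (CFC.sqrt A) * CFC.sqrt A = A := by
  rw [adjoint_sqrt, CFC.sqrt_mul_sqrt_self A hA]

/-- The trace of the product of two positive operators. -/
def trMul (A B : E →L[ℂ] E) : ℝ≥0∞ := hsSq (CFC.sqrt A * CFC.sqrt B)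

theorem trMul_comm (A B : E →L[ℂ] E) : trMul A B = trMul B A := by
  rw [trMul, ← hsSq_adjoint]
  change hsSq (star _) = _
  rw [star_mul]
  change hsSq (adjoint _ * adjoint _) = _
  rw [adjoint_sqrt, adjoint_sqrt, trMul]

theorem trMul_eq_tsum {ι : Type*} (b : HilbertBasis ι ℂ E) {A : E →L[ℂ] E} (hA : 0 ≤ A)
    (B : E →L[ℂ] E) : trMul A B = ∑' i, ENNReal.ofReal (qf A (CFC.sqrt B (b i))) := by
  rw [trMul, hsSq_eq_tsum b]
  exact tsum_congr fun i => by rw [ofReal_qf_eq (adjoint_sqrt_mul_sqrt hA)]; rfl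

theorem trMul_eq_tsum' {ι : Type*} (b : HilbertBasis ι ℂ E) (A : E →L[ℂ] E)
    {B : E →L[ℂ] E} (hB : 0 ≤ B) :
    trMul A B = ∑' i, ENNReal.ofReal (qf B (CFC.sqrt A (b i))) := by
  rw [trMul_comm, trMul_eq_tsum b hB]

theorem trMul_mono_right (A : E →L[ℂ] E) {B B' : E →L[ℂ] E} (hB : 0 ≤ B) (h : B ≤ B') :
    trMul A B ≤ trMul A B' := by
  rw [trMul_eq_tsum' (stdBasis E) A hB, trMul_eq_tsum' (stdBasis E) A (hB.trans h)]
  exact ENNReal.tsum_le_tsum fun i => ENNReal.ofReal_le_ofReal (qf_mono h _)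

theorem trMul_smul_right (A : E →L[ℂ] E) {B : E →L[ℂ] E} (hB : 0 ≤ B) {b : ℝ} (hb : 0 ≤ b) :
    trMul A (b • B) = ENNReal.ofReal b * trMul A B := by
  rw [trMul_eq_tsum' (stdBasis E) A hB, trMul_eq_tsum' (stdBasis E) A (smul_nonneg hb hB),
    ← ENNReal.tsum_mul_left]
  exact tsum_congr fun i => by rw [qf_smul, ENNReal.ofReal_mul hb]

theorem trMul_add_right (A : E →L[ℂ] E) {B B' : E →L[ℂ] E} (hB : 0 ≤ B) (hB' : 0 ≤ B') :
    trMul A (B + B') = trMul A B + trMul A B' := by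
  rw [trMul_eq_tsum' (stdBasis E) A hB, trMul_eq_tsum' (stdBasis E) A hB',
    trMul_eq_tsum' (stdBasis E) A (add_nonneg hB hB'), ← ENNReal.tsum_add]
  exact tsum_congr fun i => by
    rw [qf_add, ENNReal.ofReal_add (qf_nonneg hB _) (qf_nonneg hB' _)]

theorem trMul_sum_smul_left {ι : Type*} (s : Finset ι) {A : ι → E →L[ℂ] E}
    (hA : ∀ i ∈ s, 0 ≤ A i) {p : ι → ℝ} (hp : ∀ i ∈ s, 0 ≤ p i) (B : E →L[ℂ] E) :
    trMul (∑ i ∈ s, p i • A i) B = ∑ i ∈ s, ENNReal.ofReal (p i) * trMul (A i) B := by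
  rw [trMul_eq_tsum (stdBasis E) (Finset.sum_nonneg fun i hi => smul_nonneg (hp i hi) (hA i hi))]
  have : ∀ i ∈ s, ENNReal.ofReal (p i) * trMul (A i) B =
      ∑' v, ENNReal.ofReal (p i * qf (A i) (CFC.sqrt B (stdBasis E v))) := fun i hi => by
    rw [trMul_eq_tsum (stdBasis E) (hA i hi), ← ENNReal.tsum_mul_left]
    exact tsum_congr fun v => by rw [ENNReal.ofReal_mul (hp i hi)]
  rw [Finset.sum_congr rfl this, ← Summable.tsum_finsetSum fun i _ => ENNReal.summable]
  refine tsum_congr fun v => ?_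
  rw [qf_sum, ENNReal.ofReal_sum_of_nonneg]
  · simp_rw [qf_smul]
  · intro i hi
    rw [qf_smul]
    exact mul_nonneg (hp i hi) (qf_nonneg (hA i hi) _)

theorem qf_conj (U A : E →L[ℂ] E) (x : E) : qf (star U * A * U) x = qf A (U x) := by
  rw [qf, qf, mul_apply_eq_comp, mul_apply_eq_comp,
    ContinuousLinearMap.star_eq_adjoint, ContinuousLinearMap.adjoint_inner_right]

theorem trMul_conj (U : E →L[ℂ] E) {A B : E →L[ℂ] E} (hA : 0 ≤ A) (hB : 0 ≤ B) :
    trMul (U * A * star U) B = trMul A (star U * B * U) := by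
  rw [trMul_eq_tsum (stdBasis E) (star_right_conjugate_nonneg hA U),
    trMul_eq_tsum' (stdBasis E) A (star_left_conjugate_nonneg hB U)]
  have h1 : ∀ x, ENNReal.ofReal (qf (U * A * star U) (CFC.sqrt B x)) =
      ‖(CFC.sqrt A * star U * CFC.sqrt B) x‖ₑ ^ 2 := fun x => by
    have := qf_conj (star U) A (CFC.sqrt B x)
    rw [star_star] at this
    rw [this, ofReal_qf_eq (adjoint_sqrt_mul_sqrt hA)]
    rfl
  have h2 : ∀ x, ENNReal.ofReal (qf (star U * B * U) (CFC.sqrt A x)) =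
      ‖adjoint (CFC.sqrt A * star U * CFC.sqrt B) x‖ₑ ^ 2 := fun x => by
    rw [qf_conj, ofReal_qf_eq (adjoint_sqrt_mul_sqrt hB), ← ContinuousLinearMap.star_eq_adjoint,
      star_mul, star_mul, star_star, ContinuousLinearMap.star_eq_adjoint,
      ContinuousLinearMap.star_eq_adjoint, adjoint_sqrt, adjoint_sqrt]
    rfl
  simp_rw [h1, h2]
  exact (hsSq_adjoint _).symm

theorem traceENN_eq_hsSq {A X : E →L[ℂ] E} (h : adjoint X * X = A) : traceENN A = hsSq X := by
  apply le_antisymm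
  · refine iSup_le fun n => iSup_le fun e => iSup_le fun he => ?_
    simp_rw [ofReal_qf_eq h, ← tsum_enorm_inner_sq (stdBasis E) (X (e _))]
    rw [← Summable.tsum_finsetSum fun i _ => ENNReal.summable, ← hsSq_adjoint, hsSq]
    refine ENNReal.tsum_le_tsum fun v => ?_
    have := he.sum_inner_products_le (s := Finset.univ) (adjoint X (stdBasis E v))
    have h2 := ENNReal.ofReal_le_ofReal this
    rw [ENNReal.ofReal_sum_of_nonneg fun _ _ => sq_nonneg _,
      ENNReal.ofReal_pow (norm_nonneg _), ofReal_norm] at h2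
    refine le_trans (Finset.sum_le_sum fun i _ => le_of_eq ?_) h2
    rw [ENNReal.ofReal_pow (norm_nonneg _), ofReal_norm,
      ContinuousLinearMap.adjoint_inner_right, ← inner_conj_symm, RCLike.enorm_conj]
  · rw [hsSq, ENNReal.tsum_eq_iSup_sum]
    refine iSup_le fun s => ?_
    let e : Fin s.card → E := fun i => stdBasis E (s.equivFin.symm i)
    have he : Orthonormal ℂ e :=
      (stdBasis E).orthonormal.comp _ (Subtype.val_injective.comp s.equivFin.symm.injective)
    refine le_trans (le_of_eq ?_) (le_iSup_of_le s.card (le_iSup_of_le e (le_iSup_of_le he le_rfl)))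
    simp_rw [ofReal_qf_eq h]
    rw [← Finset.sum_coe_sort, ← s.equivFin.symm.sum_comp]

theorem traceENN_eq {A : E →L[ℂ] E} (hA : 0 ≤ A) : traceENN A = hsSq (CFC.sqrt A) :=
  traceENN_eq_hsSq (adjoint_sqrt_mul_sqrt hA)

theorem traceENN_eq_tsum {ι : Type*} (b : HilbertBasis ι ℂ E) {A : E →L[ℂ] E} (hA : 0 ≤ A) :
    traceENN A = ∑' i, ENNReal.ofReal (qf A (b i)) := by
  rw [traceENN_eq hA, hsSq_eq_tsum b]
  exact tsum_congr fun i => by rw [ofReal_qf_eq (adjoint_sqrt_mul_sqrt hA)]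

theorem trMul_one_right {A : E →L[ℂ] E} (hA : 0 ≤ A) : trMul A 1 = traceENN A := by
  rw [trMul, CFC.sqrt_one, mul_one, traceENN_eq hA]

theorem traceENN_conj {U A : E →L[ℂ] E} (hU : U ∈ unitary (E →L[ℂ] E)) (hA : 0 ≤ A) :
    traceENN (star U * A * U) = traceENN A := by
  rw [← trMul_one_right (star_left_conjugate_nonneg hA U), trMul_comm,
    ← trMul_conj U zero_le_one hA, mul_one, Unitary.mul_star_self_of_mem hU, trMul_comm,
    trMul_one_right hA]

theorem hsSq_conj {U : E →L[ℂ] E} (hU : U ∈ unitary (E →L[ℂ] E)) (X : E →L[ℂ] E) :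
    hsSq (star U * X * U) = hsSq X := by
  rw [← traceENN_eq_hsSq (X := X) rfl, ← traceENN_eq_hsSq (X := star U * X * U) rfl]
  simp only [← ContinuousLinearMap.star_eq_adjoint]
  rw [← traceENN_conj hU (star_mul_self_nonneg X)]
  congr 1
  simp only [star_mul, star_star]
  rw [show star U * (star X * U) * (star U * X * U) = star U * (star X * (U * star U) * X) * U by
    noncomm_ring, Unitary.mul_star_self_of_mem hU, mul_one]

end HilbertSchmidt

section TraceEstimates

variable {E : Type*} [NormedAddCommGroup E] [InnerProductSpace ℂ E] [CompleteSpace E]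

open ContinuousLinearMap (adjoint)

theorem enorm_sq_apply_le (X : E →L[ℂ] E) (x : E) : ‖X x‖ₑ ^ 2 ≤ hsSq X * ‖x‖ₑ ^ 2 := by
  rw [← tsum_enorm_inner_sq (stdBasis E) (X x), ← hsSq_adjoint, hsSq, ← ENNReal.tsum_mul_right]
  refine ENNReal.tsum_le_tsum fun v => ?_
  rw [← ContinuousLinearMap.adjoint_inner_left, ← mul_pow]
  gcongr
  simp only [← ofReal_norm]
  rw [← ENNReal.ofReal_mul (norm_nonneg _)]
  exact ENNReal.ofReal_le_ofReal (norm_inner_le_norm _ _)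

theorem norm_sq_le_toReal_hsSq {X : E →L[ℂ] E} (hX : hsSq X ≠ ∞) :
    ‖X‖ ^ 2 ≤ (hsSq X).toReal := by
  have h : ‖X‖ ≤ √(hsSq X).toReal := by
    refine X.opNorm_le_bound (Real.sqrt_nonneg _) fun x => ?_
    have h1 := ENNReal.toReal_mono (ENNReal.mul_ne_top hX (by simp)) (enorm_sq_apply_le X x)
    simp only [ENNReal.toReal_mul, ENNReal.toReal_pow, toReal_enorm] at h1
    refine abs_le_of_sq_le_sq' ?_ (by positivity) |>.2
    rw [mul_pow, Real.sq_sqrt ENNReal.toReal_nonneg]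
    exact h1
  calc ‖X‖ ^ 2 ≤ √(hsSq X).toReal ^ 2 := by gcongr
    _ = _ := Real.sq_sqrt ENNReal.toReal_nonneg

theorem hsSq_add_add_hsSq_sub (X Y : E →L[ℂ] E) :
    hsSq (X + Y) + hsSq (X - Y) = 2 * (hsSq X + hsSq Y) := by
  simp_rw [hsSq]
  rw [← ENNReal.tsum_add, ← ENNReal.tsum_add, ← ENNReal.tsum_mul_left]
  refine tsum_congr fun v => ?_
  have h := congrArg ENNReal.ofReal
    (parallelogram_law_with_norm ℂ (X (stdBasis E v)) (Y (stdBasis E v)))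
  rw [ENNReal.ofReal_add (by positivity) (by positivity), ENNReal.ofReal_mul (by norm_num),
    ENNReal.ofReal_add (by positivity) (by positivity)] at h
  simpa [ENNReal.ofReal_mul, ← sq] using h

theorem hsSq_smul (c : ℝ) (X : E →L[ℂ] E) : hsSq (c • X) = ‖c‖ₑ ^ 2 * hsSq X := by
  rw [hsSq, hsSq, ← ENNReal.tsum_mul_left]
  exact tsum_congr fun v => by rw [smul_apply, enorm_smul, mul_pow]

theorem hsSq_add_ne_top {X Y : E →L[ℂ] E} (hX : hsSq X ≠ ∞) (hY : hsSq Y ≠ ∞) :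
    hsSq (X + Y) ≠ ∞ ∧ hsSq (X - Y) ≠ ∞ := by
  have h : hsSq (X + Y) + hsSq (X - Y) ≠ ∞ := by
    rw [hsSq_add_add_hsSq_sub]
    exact ENNReal.mul_ne_top (by simp) (ENNReal.add_ne_top.2 ⟨hX, hY⟩)
  exact ENNReal.add_ne_top.1 h

theorem norm_sub_sq_le_hsSq {X Y : E →L[ℂ] E} (hX : hsSq X ≠ ∞) (hY : hsSq Y ≠ ∞) :
    ‖X - Y‖ ^ 2 ≤ 2 * ((hsSq X).toReal + (hsSq Y).toReal)
      - 4 * (hsSq ((1 / 2 : ℝ) • (X + Y))).toReal := by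
  obtain ⟨h1, h2⟩ := hsSq_add_ne_top hX hY
  have h := congrArg ENNReal.toReal (hsSq_add_add_hsSq_sub X Y)
  rw [ENNReal.toReal_add h1 h2, ENNReal.toReal_mul, ENNReal.toReal_add hX hY] at h
  have h3 := norm_sq_le_toReal_hsSq h2
  rw [hsSq_smul, ENNReal.toReal_mul, ENNReal.toReal_pow, toReal_enorm]
  norm_num at h ⊢
  linarith

theorem hasSum_norm_sq {X : E →L[ℂ] E} (hX : hsSq X ≠ ∞) :
    HasSum (fun v : stdONB E => ‖X (stdBasis E v)‖ ^ 2) (hsSq X).toReal := by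
  have h := ENNReal.hasSum_toReal hX
  rw [← ENNReal.tsum_toReal_eq (by simp)] at h
  simpa [hsSq] using h

theorem hasSum_re_inner {X Y : E →L[ℂ] E} (hX : hsSq X ≠ ∞) (hY : hsSq Y ≠ ∞) :
    HasSum (fun v : stdONB E => (inner ℂ (X (stdBasis E v)) (Y (stdBasis E v)) : ℂ).re)
      (((hsSq (X + Y)).toReal - (hsSq (X - Y)).toReal) / 4) := by
  obtain ⟨h1, h2⟩ := hsSq_add_ne_top hX hY
  have h := ((hasSum_norm_sq h1).sub (hasSum_norm_sq h2)).div_const 4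
  convert! h using 2 with v
  have := @re_inner_eq_norm_add_mul_self_sub_norm_sub_mul_self_div_four ℂ E _ _ _
    (X (stdBasis E v)) (Y (stdBasis E v))
  rw [add_apply, sub_apply, sq, sq]
  exact this

theorem hsSq_mul_ne_top {X : E →L[ℂ] E} (hX : hsSq X ≠ ∞) (Y : E →L[ℂ] E) :
    hsSq (Y * X) ≠ ∞ := by
  refine ne_top_of_le_ne_top (ENNReal.mul_ne_top (a := ‖Y‖ₑ ^ 2) (by simp) hX) ?_
  rw [hsSq, hsSq, ← ENNReal.tsum_mul_left]
  refine ENNReal.tsum_le_tsum fun v => ?_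
  rw [← mul_pow]
  gcongr
  exact Y.le_opENorm _

theorem ofReal_re_traceC_mul_le {A B : E →L[ℂ] E} (hA : 0 ≤ A) (hA' : traceENN A ≠ ∞)
    (hB : 0 ≤ B) : ENNReal.ofReal (traceC (A * B)).re ≤ trMul A B := by
  rw [traceENN_eq hA] at hA'
  by_cases hsum : Summable fun v : stdONB E => (inner ℂ (v : E) ((A * B) v) : ℂ)
  swap
  · rw [traceC, tsum_eq_zero_of_not_summable hsum]
    simp
  have hadj : adjoint (CFC.sqrt A * B) = B * CFC.sqrt A := by
    rw [← ContinuousLinearMap.star_eq_adjoint, star_mul, (IsSelfAdjoint.of_nonneg hB).star_eq,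
      (IsSelfAdjoint.of_nonneg (CFC.sqrt_nonneg A)).star_eq]
  have hY : hsSq (B * CFC.sqrt A) ≠ ∞ := hsSq_mul_ne_top hA' B
  have hY' : hsSq (CFC.sqrt A * B) ≠ ∞ := by rwa [← hsSq_adjoint, hadj]
  have h1 := hasSum_re_inner hA' hY'
  have h2 := hasSum_re_inner hA' hY
  rw [← hsSq_adjoint (_ + _), ← hsSq_adjoint (_ - _), map_add, map_sub, hadj, adjoint_sqrt] at h1
  have h3 := Complex.hasSum_re hsum.hasSum
  have h4 : (traceC (A * B)).re = ∑' v : stdONB E, qf B (CFC.sqrt A (stdBasis E v)) := by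
    have h5 : (fun v : stdONB E => (inner ℂ (v : E) ((A * B) v) : ℂ).re) = fun v =>
        (inner ℂ (CFC.sqrt A (stdBasis E v)) ((CFC.sqrt A * B) (stdBasis E v)) : ℂ).re := by
      ext v
      nth_rw 1 [← adjoint_sqrt_mul_sqrt hA]
      rw [mul_assoc, mul_apply_eq_comp, ContinuousLinearMap.adjoint_inner_right, stdBasis_apply]
    rw [h5] at h3
    rw [traceC, h3.unique h1, ← h2.tsum_eq]
    rfl
  rw [h4, ENNReal.ofReal_tsum_of_nonneg (fun v => qf_nonneg hB _) h2.summable,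
    trMul_eq_tsum' (stdBasis E) A hB]

theorem continuous_qf (x : E) : Continuous fun A : E →L[ℂ] E => qf A x := by
  unfold qf
  fun_prop

theorem isClosed_hsSq_le (c : ℝ≥0∞) : IsClosed {X : E →L[ℂ] E | hsSq X ≤ c} := by
  have : {X : E →L[ℂ] E | hsSq X ≤ c} =
      ⋂ s : Finset (stdONB E), {X | ∑ v ∈ s, ‖X (stdBasis E v)‖ₑ ^ 2 ≤ c} := by
    ext X
    simp [hsSq, ENNReal.tsum_eq_iSup_sum]
  rw [this]
  refine isClosed_iInter fun s => isClosed_le ?_ continuous_const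
  refine continuous_finsetSum _ fun v _ => (ENNReal.continuous_pow 2).comp ?_
  exact continuous_enorm.comp (by fun_prop)

theorem isClosed_traceENN_le (c : ℝ≥0∞) : IsClosed {A : E →L[ℂ] E | traceENN A ≤ c} := by
  simp only [traceENN, iSup_le_iff, Set.ofPred_forall]
  refine isClosed_iInter fun n => isClosed_iInter fun e => isClosed_iInter fun he =>
    isClosed_le ?_ continuous_const
  exact continuous_finsetSum _ fun v _ => ENNReal.continuous_ofReal.comp (continuous_qf _)

theorem isClosed_trMul_le (A : E →L[ℂ] E) (c : ℝ≥0∞) :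
    IsClosed {B : E →L[ℂ] E | ∑' v, ENNReal.ofReal (qf B (CFC.sqrt A (stdBasis E v))) ≤ c} := by
  simp only [ENNReal.tsum_eq_iSup_sum, iSup_le_iff, Set.ofPred_forall]
  refine isClosed_iInter fun s => isClosed_le ?_ continuous_const
  exact continuous_finsetSum _ fun v _ => ENNReal.continuous_ofReal.comp (continuous_qf _)

end TraceEstimates

section ConvexAnalysis

theorem exists_forall_lt_of_convexOn {V ι : Type*} [AddCommGroup V] [Module ℝ V] [Fintype ι]
    {K : Set V} (hK : Convex ℝ K) (hne : K.Nonempty) {f : ι → V → ℝ}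
    (hf : ∀ i, ConvexOn ℝ K (f i)) {a b : ℝ} (hab : a < b)
    (h : ∀ p : ι → ℝ, (∀ i, 0 ≤ p i) → ∑ i, p i = 1 → ∃ x ∈ K, ∑ i, p i * f i x ≤ a) :
    ∃ x ∈ K, ∀ i, f i x < b := by
  by_contra hcon
  let W : Set (ι → ℝ) := {y | ∃ x ∈ K, ∀ i, f i x < y i}
  have hWo : IsOpen W := by
    have : W = ⋃ x ∈ K, {y | ∀ i, f i x < y i} := by ext; simp [W]
    rw [this]
    refine isOpen_biUnion fun x _ => ?_
    rw [Set.ofPred_forall]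
    exact isOpen_iInter_of_finite fun i => isOpen_lt continuous_const (continuous_apply i)
  have hWc : Convex ℝ W := by
    rintro y ⟨x, hx, hxy⟩ y' ⟨x', hx', hxy'⟩ s t hs ht hst
    refine ⟨s • x + t • x', hK hx hx' hs ht hst, fun i => ?_⟩
    refine ((hf i).2 hx hx' hs ht hst).trans_lt ?_
    simp only [smul_eq_mul, Pi.add_apply, Pi.smul_apply]
    rcases hs.eq_or_lt with rfl | hs'
    · have : t = 1 := by linarith
      simpa [this] using hxy' i
    · nlinarith [mul_lt_mul_of_pos_left (hxy i) hs', mul_le_mul_of_nonneg_left (hxy' i).le ht]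
  obtain ⟨φ, hφ⟩ := geometric_hahn_banach_open_point hWc hWo
    (show (fun _ => b : ι → ℝ) ∉ W from hcon)
  let q : ι → ℝ := fun i => -φ (Pi.single i 1)
  have hφq : ∀ y, φ y = -∑ i, q i * y i := by
    intro y
    have hy : y = ∑ i, y i • (Pi.single i 1 : ι → ℝ) := by
      ext j
      simp [Finset.sum_apply, Pi.single_apply]
    conv_lhs => rw [hy]
    rw [map_sum, ← Finset.sum_neg_distrib]
    exact Finset.sum_congr rfl fun i _ => by simp only [map_smul, smul_eq_mul, q]; ring
  have hlt : ∀ x ∈ K, ∀ y : ι → ℝ, (∀ i, f i x < y i) → ∑ i, q i * b < ∑ i, q i * y i := by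
    intro x hx y hy
    have := hφ y ⟨x, hx, hy⟩
    rw [hφq, hφq] at this
    linarith
  obtain ⟨x₀, hx₀⟩ := hne
  have hq : ∀ i, 0 ≤ q i := by
    intro i
    by_contra! hi
    let t := max 0 ((∑ j, q j * (f j x₀ + 1) - ∑ j, q j * b) / (-q i))
    have h1 := hlt x₀ hx₀ (fun j => (f j x₀ + 1) + (Pi.single i t : ι → ℝ) j) fun j => by
      have : 0 ≤ (Pi.single i t : ι → ℝ) j := by
        rw [Pi.single_apply]
        split_ifs
        · exact le_max_left _ _
        · exact le_rfl
      linarith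
    simp only [mul_add, Finset.sum_add_distrib, Pi.single_apply, mul_ite, mul_zero,
      Finset.sum_ite_eq', Finset.mem_univ, if_true] at h1
    have h2 : (∑ j, q j * (f j x₀ + 1) - ∑ j, q j * b) / (-q i) ≤ t := le_max_right _ _
    rw [div_le_iff₀ (by linarith)] at h2
    simp only [mul_add, Finset.sum_add_distrib] at h2
    linarith
  have hQ : 0 < ∑ i, q i := by
    refine lt_of_le_of_ne (Finset.sum_nonneg fun i _ => hq i) fun h0 => ?_
    have h1 := (Finset.sum_eq_zero_iff_of_nonneg fun i _ => hq i).1 h0.symm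
    have h2 := hlt x₀ hx₀ (fun j => f j x₀ + 1) fun j => by linarith
    rw [Finset.sum_eq_zero fun i hi => by rw [h1 i hi, zero_mul],
      Finset.sum_eq_zero fun i hi => by rw [h1 i hi, zero_mul]] at h2
    exact lt_irrefl _ h2
  obtain ⟨x, hx, hxa⟩ := h (fun i => q i / ∑ j, q j) (fun i => div_nonneg (hq i) hQ.le)
    (by rw [← Finset.sum_div, div_self hQ.ne'])
  simp only [div_mul_eq_mul_div, ← Finset.sum_div] at hxa
  rw [div_le_iff₀ hQ] at hxa
  have h3 := hlt x hx (fun i => f i x + (b - a)) fun i => by linarith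
  simp only [mul_add, Finset.sum_add_distrib, ← Finset.sum_mul] at h3
  linarith

theorem exists_unique_minimizer {V ι : Type*} [NormedAddCommGroup V] [NormedSpace ℝ V]
    [CompleteSpace V] {K : Set V} {F : ι → Set V} {q : V → ℝ}
    (hq₀ : ∀ x ∈ K, 0 ≤ q x) (hq₁ : ∀ x ∈ K, q x ≤ 1)
    (hq : ∀ c : ℝ, IsClosed {x | x ∈ K ∧ q x ≤ c})
    (hpar : ∀ x ∈ K, ∀ y ∈ K, ‖x - y‖ ^ 2 ≤ 2 * (q x + q y) - 4 * q ((1 / 2 : ℝ) • (x + y)))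
    (hK : Convex ℝ K) (hF : ∀ i, IsClosed (K ∩ F i)) (hF' : ∀ i, Convex ℝ (K ∩ F i))
    (hne : ∀ S : Finset ι, ∃ x ∈ K, ∀ i ∈ S, x ∈ F i) :
    ∃ x ∈ K, (∀ i, x ∈ F i) ∧ ∀ y ∈ K, (∀ i, y ∈ F i) → q y ≤ q x → y = x := by
  have hmid : ∀ {C : Set V}, Convex ℝ C → ∀ x ∈ C, ∀ y ∈ C, (1 / 2 : ℝ) • (x + y) ∈ C := by
    intro C hC x hx y hy
    rw [smul_add]
    exact hC hx hy (by norm_num) (by norm_num) (by norm_num)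
  let D : Finset ι → Set V := fun S => {x | x ∈ K ∧ ∀ i ∈ S, x ∈ F i}
  have hD : ∀ S, Convex ℝ (D S) := by
    intro S x hx y hy a b ha hb hab
    exact ⟨hK hx.1 hy.1 ha hb hab, fun i hi =>
      (hF' i ⟨hx.1, hx.2 i hi⟩ ⟨hy.1, hy.2 i hi⟩ ha hb hab).2⟩
  let m : Finset ι → ℝ := fun S => sInf (q '' D S)
  have hDne : ∀ S, (q '' D S).Nonempty := fun S => Set.Nonempty.image q (hne S)
  have hbdd : ∀ S, BddBelow (q '' D S) := fun S => ⟨0, by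
    rintro _ ⟨x, hx, rfl⟩
    exact hq₀ x hx.1⟩
  have hm : ∀ S, ∀ x ∈ D S, m S ≤ q x := fun S x hx => csInf_le (hbdd S) ⟨x, hx, rfl⟩
  have hm1 : BddAbove (Set.range m) := ⟨1, by
    rintro _ ⟨S, rfl⟩
    obtain ⟨x, hx⟩ := hne S
    exact (hm S x hx).trans (hq₁ x hx.1)⟩
  set d := ⨆ S, m S with hd
  let G : Finset ι × ℕ → Set V := fun k => {x | x ∈ D k.1 ∧ q x ≤ d + 1 / (k.2 + 1 : ℝ)}
  have hGanti : ∀ k k' : Finset ι × ℕ, k.1 ⊆ k'.1 → k.2 ≤ k'.2 → G k' ⊆ G k := by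
    rintro k k' h1 h2 x ⟨hx, hx'⟩
    refine ⟨⟨hx.1, fun i hi => hx.2 i (h1 hi)⟩, hx'.trans ?_⟩
    gcongr
  have hGne : ∀ k, (G k).Nonempty := by
    intro k
    have h1 : m k.1 < d + 1 / (k.2 + 1 : ℝ) :=
      (le_ciSup hm1 k.1).trans_lt (lt_add_of_pos_right _ (by positivity))
    obtain ⟨_, ⟨x, hx, rfl⟩, hx'⟩ := exists_lt_of_csInf_lt (hDne k.1) h1
    exact ⟨x, hx, hx'.le⟩
  have hGcl : ∀ k, IsClosed (G k) := by
    intro k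
    have : G k = {x | x ∈ K ∧ q x ≤ d + 1 / (k.2 + 1 : ℝ)} ∩ ⋂ i ∈ k.1, (K ∩ F i) := by
      ext x
      simp only [G, D, Set.mem_ofPred_eq, Set.mem_inter_iff, Set.mem_iInter]
      grind
    rw [this]
    exact (hq _).inter (isClosed_biInter fun i _ => hF i)
  let l : Filter V := ⨅ k, 𝓟 (G k)
  have hdir : Directed (· ≥ ·) fun k => 𝓟 (G k) := by
    intro k k'
    refine ⟨(k.1 ∪ k'.1, max k.2 k'.2), ?_, ?_⟩
    · exact principal_mono.2 (hGanti _ _ Finset.subset_union_left (le_max_left _ _))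
    · exact principal_mono.2 (hGanti _ _ Finset.subset_union_right (le_max_right _ _))
  have hGl : ∀ k, G k ∈ l := fun k => mem_iInf_of_mem k (mem_principal_self _)
  have hl : l.NeBot := iInf_neBot_of_directed' hdir fun k => principal_neBot_iff.2 (hGne k)
  have hcauchy : Cauchy l := by
    refine Metric.cauchy_iff.2 ⟨hl, fun ε hε => ?_⟩
    obtain ⟨n, hn⟩ := exists_nat_one_div_lt (show (0 : ℝ) < ε ^ 2 / 8 by positivity)
    have h1 : d - 1 / (n + 1 : ℝ) < d := sub_lt_self _ (by positivity)
    obtain ⟨S, hS⟩ := exists_lt_of_lt_ciSup h1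
    refine ⟨G (S, n), hGl _, fun x hx y hy => ?_⟩
    have h2 := hpar x hx.1.1 y hy.1.1
    have h3 := hm S _ (hmid (hD S) x hx.1 y hy.1)
    have h4 := hx.2
    have h5 := hy.2
    rw [dist_eq_norm]
    refine lt_of_pow_lt_pow_left₀ 2 hε.le ?_
    simp only at h4 h5
    linarith
  obtain ⟨x, hx⟩ := CompleteSpace.complete hcauchy
  have hxG : ∀ k, x ∈ G k := fun k => (hGcl k).mem_of_tendsto (f := id) (b := l) hx (hGl k)
  have hxF : ∀ i, x ∈ F i := fun i => (hxG ({i}, 0)).1.2 i (by simp)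
  have hxd : q x ≤ d := le_of_forall_pos_le_add fun ε hε => by
    obtain ⟨n, hn⟩ := exists_nat_one_div_lt hε
    exact (hxG (∅, n)).2.trans (by simpa using hn.le)
  refine ⟨x, (hxG (∅, 0)).1.1, hxF, fun y hy hyF hyx => ?_⟩
  have hxK := (hxG (∅, 0)).1.1
  have h1 : d ≤ q ((1 / 2 : ℝ) • (x + y)) := ciSup_le fun S =>
    hm S _ (hmid (hD S) x ⟨hxK, fun i _ => hxF i⟩ y ⟨hy, fun i _ => hyF i⟩)
  have h2 := hpar x hxK y hy
  have h3 : ‖x - y‖ ^ 2 ≤ 0 := by linarith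
  have h4 : ‖x - y‖ = 0 := by
    rw [← sq_eq_zero_iff]
    exact le_antisymm h3 (sq_nonneg _)
  exact (sub_eq_zero.1 (norm_eq_zero.1 h4)).symm

end ConvexAnalysis

section NegLogOp

variable {E : Type*} [NormedAddCommGroup E] [InnerProductSpace ℂ E] [CompleteSpace E]

/-- The set `𝔗₁(E)` of positive operators with trace at most one. -/
def subStates (E : Type*) [NormedAddCommGroup E] [InnerProductSpace ℂ E] [CompleteSpace E] :
    Set (E →L[ℂ] E) := {T | 0 ≤ T ∧ traceENN T ≤ 1}

theorem norm_le_one_of_mem_subStates {T : E →L[ℂ] E} (hT : T ∈ subStates E) : ‖T‖ ≤ 1 := by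
  have h1 : traceENN T = hsSq (CFC.sqrt T) := traceENN_eq hT.1
  have h2 : hsSq (CFC.sqrt T) ≤ 1 := h1 ▸ hT.2
  have h3 := norm_sq_le_toReal_hsSq (ne_top_of_le_ne_top ENNReal.one_ne_top h2)
  have h4 : (hsSq (CFC.sqrt T)).toReal ≤ 1 := ENNReal.toReal_le_of_le_ofReal zero_le_one (by simpa)
  calc ‖T‖ = ‖CFC.sqrt T * CFC.sqrt T‖ := by rw [CFC.sqrt_mul_sqrt_self T hT.1]
    _ ≤ ‖CFC.sqrt T‖ * ‖CFC.sqrt T‖ := norm_mul_le _ _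
    _ ≤ 1 := by nlinarith

theorem spectrum_subset_Icc {T : E →L[ℂ] E} (hT : T ∈ subStates E) :
    spectrum ℝ T ⊆ Set.Icc 0 1 := fun x hx =>
  ⟨spectrum_nonneg_of_nonneg hT.1 hx, (le_abs_self x).trans
    ((IsometricContinuousFunctionalCalculus.norm_spectrum_le T hx hT.1.isSelfAdjoint).trans
      (norm_le_one_of_mem_subStates hT))⟩

theorem hsSq_le_one {T : E →L[ℂ] E} (hT : T ∈ subStates E) : hsSq T ≤ 1 := by
  have h : T ≤ 1 := by
    simpa using (CStarAlgebra.norm_le_iff_le_algebraMap T zero_le_one hT.1).1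
      (norm_le_one_of_mem_subStates hT)
  calc hsSq T = trMul T T := by rw [trMul, CFC.sqrt_mul_sqrt_self T hT.1]
    _ ≤ trMul T 1 := trMul_mono_right T hT.1 h
    _ ≤ 1 := (trMul_one_right hT.1).trans_le hT.2

theorem traceENN_add_smul {A B : E →L[ℂ] E} (hA : 0 ≤ A) (hB : 0 ≤ B) {a b : ℝ} (ha : 0 ≤ a)
    (hb : 0 ≤ b) : traceENN (a • A + b • B) =
      ENNReal.ofReal a * traceENN A + ENNReal.ofReal b * traceENN B := by
  have h : ∀ X : E →L[ℂ] E, 0 ≤ X → traceENN X = trMul 1 X := fun X hX => by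
    rw [← trMul_one_right hX, trMul_comm]
  rw [h _ (add_nonneg (smul_nonneg ha hA) (smul_nonneg hb hB)), h _ hA, h _ hB,
    trMul_add_right _ (smul_nonneg ha hA) (smul_nonneg hb hB), trMul_smul_right _ hA ha,
    trMul_smul_right _ hB hb]

theorem convex_subStates : Convex ℝ (subStates E) := by
  intro A hA B hB a b ha hb hab
  refine ⟨add_nonneg (smul_nonneg ha hA.1) (smul_nonneg hb hB.1), ?_⟩
  rw [traceENN_add_smul hA.1 hB.1 ha hb]
  calc _ ≤ ENNReal.ofReal a * 1 + ENNReal.ofReal b * 1 := by gcongr; exacts [hA.2, hB.2]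
    _ = 1 := by rw [mul_one, mul_one, ← ENNReal.ofReal_add ha hb, hab, ENNReal.ofReal_one]

theorem isClosed_subStates : IsClosed (subStates E) :=
  CStarAlgebra.isClosed_nonneg.inter (isClosed_traceENN_le 1)

theorem zero_mem_subStates : (0 : E →L[ℂ] E) ∈ subStates E :=
  ⟨le_rfl, by simp [traceENN, qf]⟩

theorem conj_mem_subStates {U T : E →L[ℂ] E} (hU : U ∈ unitary (E →L[ℂ] E))
    (hT : T ∈ subStates E) : star U * T * U ∈ subStates E :=
  ⟨star_left_conjugate_nonneg hT.1 U, (traceENN_conj hU hT.1).trans_le hT.2⟩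

/-- A bounded approximation of `-log T`, nonnegative for `0 ≤ T ≤ 1`. -/
def negLogOp (ε : ℝ) (T : E →L[ℂ] E) : E →L[ℂ] E :=
  cfc (fun x : ℝ => Real.log (1 + ε) - Real.log (x + ε)) T

theorem continuousOn_log_add {ε : ℝ} (hε : 0 < ε) :
    ContinuousOn (fun x : ℝ => Real.log (x + ε)) (Set.Ici 0) :=
  ContinuousOn.log (by fun_prop) fun x (hx : 0 ≤ x) => by positivity

theorem continuousOn_negLog {ε : ℝ} (hε : 0 < ε) :
    ContinuousOn (fun x : ℝ => Real.log (1 + ε) - Real.log (x + ε)) (Set.Ici 0) :=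
  continuousOn_const.sub (continuousOn_log_add hε)

theorem spectrum_subset_Ici {T : E →L[ℂ] E} (hT : 0 ≤ T) : spectrum ℝ T ⊆ Set.Ici 0 :=
  fun _ hx => spectrum_nonneg_of_nonneg hT hx

theorem negLogOp_nonneg {ε : ℝ} (hε : 0 < ε) {T : E →L[ℂ] E} (hT : T ∈ subStates E) :
    0 ≤ negLogOp ε T :=
  cfc_nonneg fun x hx => by
    obtain ⟨h0, h1⟩ := spectrum_subset_Icc hT hx
    exact sub_nonneg.2 (Real.log_le_log (by positivity) (by linarith))

theorem negLogOp_anti {ε δ : ℝ} (hε : 0 < ε) (h : ε ≤ δ) {T : E →L[ℂ] E}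
    (hT : T ∈ subStates E) : negLogOp δ T ≤ negLogOp ε T := by
  have hs := spectrum_subset_Ici hT.1
  refine cfc_mono (fun x hx => ?_) ((continuousOn_negLog (hε.trans_le h)).mono hs)
    ((continuousOn_negLog hε).mono hs)
  obtain ⟨h0, h1⟩ := spectrum_subset_Icc hT hx
  have hδ := hε.trans_le h
  rw [← Real.log_div (by positivity) (by positivity), ← Real.log_div (by positivity)
    (by positivity)]
  refine Real.log_le_log (by positivity) ?_
  rw [div_le_div_iff₀ (by positivity) (by positivity)]
  nlinarith

theorem negLogOp_le {ε : ℝ} (hε : 0 < ε) {T : E →L[ℂ] E} (hT : 0 ≤ T) :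
    negLogOp ε T ≤ (Real.log (1 + ε) - Real.log ε) • 1 := by
  rw [← Algebra.algebraMap_eq_smul_one]
  refine cfc_le_algebraMap _ _ _ (fun x hx => ?_)
    ((continuousOn_negLog hε).mono (spectrum_subset_Ici hT)) hT.isSelfAdjoint
  have : (0 : ℝ) ≤ x := spectrum_nonneg_of_nonneg hT hx
  exact sub_le_sub_left (Real.log_le_log hε (by linarith)) _

theorem cfc_max_neg_log_le {ε : ℝ} (hε : 0 < ε) {T : E →L[ℂ] E} (hT : T ∈ subStates E) :
    cfc (fun x : ℝ => max 0 (-(Real.log (x + ε)))) T ≤ negLogOp ε T := by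
  have hs := spectrum_subset_Ici hT.1
  refine cfc_mono (fun x hx => ?_)
    ((continuousOn_const.sup (continuousOn_log_add hε).neg).mono hs)
    ((continuousOn_negLog hε).mono hs)
  obtain ⟨h0, h1⟩ := spectrum_subset_Icc hT hx
  refine max_le (sub_nonneg.2 (Real.log_le_log (by positivity) (by linarith))) ?_
  linarith [Real.log_nonneg (show (1 : ℝ) ≤ 1 + ε by linarith)]

theorem negLogOp_eq {ε : ℝ} (hε : 0 < ε) {T : E →L[ℂ] E} (hT : 0 ≤ T) :
    negLogOp ε T = algebraMap ℝ _ (Real.log (1 + ε)) - CFC.log (T + algebraMap ℝ _ ε) := by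
  have hs := spectrum_subset_Ici hT
  have hT' : IsSelfAdjoint T := hT.isSelfAdjoint
  have hlog : ContinuousOn Real.log ((fun x => x + ε) '' spectrum ℝ T) := by
    refine Real.continuousOn_log.mono ?_
    rintro _ ⟨x, hx, rfl⟩
    have : (0 : ℝ) ≤ x := hs hx
    exact (by positivity : x + ε ≠ 0)
  have h : CFC.log (T + algebraMap ℝ _ ε) = cfc (fun x : ℝ => Real.log (x + ε)) T := by
    rw [CFC.log, cfc_comp' Real.log (fun x => x + ε) T, cfc_add_const ε (fun x => x) T,
      cfc_id' ℝ T]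
  rw [h, negLogOp, cfc_sub (fun _ => Real.log (1 + ε)) _ T continuousOn_const
    ((continuousOn_log_add hε).mono hs), cfc_const _ T]

theorem convexOn_negLogOp {ε : ℝ} (hε : 0 < ε) :
    ConvexOn ℝ (subStates E) (negLogOp ε) := by
  refine ⟨convex_subStates, fun A hA B hB a b ha hb hab => ?_⟩
  have hpos : ∀ T : E →L[ℂ] E, 0 ≤ T → IsStrictlyPositive (T + algebraMap ℝ _ ε) := fun T hT =>
    (isStrictlyPositive_algebraMap hε).nonneg_add hT
  have key := CFC.concaveOn_log.2 (hpos A hA.1) (hpos B hB.1) ha hb hab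
  have hconst : ∀ X Y Z : E →L[ℂ] E, a • (X + Z) + b • (Y + Z) = a • X + b • Y + Z :=
    fun X Y Z => by
      obtain rfl : a = 1 - b := by linarith
      module
  rw [hconst] at key
  rw [negLogOp_eq hε (convex_subStates hA hB ha hb hab).1, negLogOp_eq hε hA.1,
    negLogOp_eq hε hB.1, sub_eq_neg_add, sub_eq_neg_add, sub_eq_neg_add, hconst, smul_neg,
    smul_neg, ← neg_add]
  gcongr

theorem continuousOn_negLogOp {ε : ℝ} (hε : 0 < ε) :
    ContinuousOn (negLogOp ε) (subStates E) :=
  (continuousOn_cfc (E →L[ℂ] E) isCompact_Icc _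
    ((continuousOn_negLog hε).mono Set.Icc_subset_Ici_self)).mono fun _ hT =>
    ⟨hT.1.isSelfAdjoint, spectrum_subset_Icc hT⟩

theorem negLogOp_conj {ε : ℝ} (hε : 0 < ε) {U T : E →L[ℂ] E} (hU : U ∈ unitary (E →L[ℂ] E))
    (hT : 0 ≤ T) : negLogOp ε (star U * T * U) = star U * negLogOp ε T * U := by
  have h := StarAlgHomClass.map_cfc (S := ℂ)
    (Unitary.conjStarAlgAut ℂ (E →L[ℂ] E) (star (⟨U, hU⟩ : unitary (E →L[ℂ] E))))
    (fun x : ℝ => Real.log (1 + ε) - Real.log (x + ε)) T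
    ((continuousOn_negLog hε).mono (spectrum_subset_Ici hT))
    (by
      simp only [funext (Unitary.conjStarAlgAut_star_apply (S := ℂ) _)]
      fun_prop)
    hT.isSelfAdjoint
    (by
      rw [Unitary.conjStarAlgAut_star_apply]
      exact (star_left_conjugate_nonneg hT U).isSelfAdjoint)
  simp only [Unitary.conjStarAlgAut_star_apply] at h
  exact h.symm

end NegLogOp

section Diagonal

variable {E : Type*} [NormedAddCommGroup E] [InnerProductSpace ℂ E]

theorem qf_eq_of_eigenvector {T : E →L[ℂ] E} {t : ℝ} {v : E} (hv : T v = t • v) :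
    qf T v = t * ‖v‖ ^ 2 := by
  rw [qf, hv, ← Complex.coe_smul, inner_smul_right, Complex.re_ofReal_mul,
    inner_self_eq_norm_sq_to_K]
  norm_cast

variable [CompleteSpace E]

theorem negLogOp_apply_of_eigenvector {ε : ℝ} (hε : 0 < ε) {T : E →L[ℂ] E} (hT : 0 ≤ T) {t : ℝ}
    (ht : 0 ≤ t) {v : E} (hv : T v = t • v) :
    negLogOp ε T v = (Real.log (1 + ε) - Real.log (t + ε)) • v := by
  set f : ℝ → ℝ := fun x => Real.log (1 + ε) - Real.log (x + ε) with hf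
  have hT' : IsSelfAdjoint T := hT.isSelfAdjoint
  have hdiff : ∀ x ∈ Set.Ioi (-ε), DifferentiableAt ℝ f x := fun x (hx : -ε < x) => by
    have : x + ε ≠ 0 := by linarith
    fun_prop (disch := assumption)
  have htm : t ∈ Set.Ioi (-ε) := show -ε < t by linarith
  have hd : ContinuousOn (dslope f t) (spectrum ℝ T) :=
    ((continuousOn_dslope (isOpen_Ioi.mem_nhds htm)).2
      ⟨fun x hx => (hdiff x hx).continuousAt.continuousWithinAt, hdiff t htm⟩).mono
      fun x hx => show -ε < x by linarith [spectrum_nonneg_of_nonneg hT hx]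
  have hfac : f = fun x => dslope f t x * (x - t) + f t := by
    ext x
    have := sub_smul_dslope f t x
    rw [smul_eq_mul] at this
    linarith
  have h : negLogOp ε T = cfc (dslope f t) T * (T - algebraMap ℝ _ t)
      + algebraMap ℝ _ (f t) := by
    rw [negLogOp, ← hf]
    conv_lhs => rw [hfac]
    rw [cfc_add_const _ (fun x => dslope f t x * (x - t)) T (hd.mul (by fun_prop)),
      cfc_mul _ _ T hd (by fun_prop), cfc_sub (fun x => x) (fun _ => t) T, cfc_id' ℝ T, cfc_const t T]
  rw [h]
  simp [Algebra.algebraMap_eq_smul_one, hv, hf]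

theorem sqrt_apply_of_eigenvector {G : E →L[ℂ] E} (hG : 0 ≤ G) {g : ℝ} (hg : 0 ≤ g) {v : E}
    (hv : G v = g • v) : CFC.sqrt G v = √g • v := by
  rw [← sub_eq_zero]
  rcases hg.eq_or_lt with rfl | hg
  · have h := qf_eq_norm_sq (adjoint_sqrt_mul_sqrt hG) v
    rw [qf_eq_of_eigenvector hv, zero_mul] at h
    simpa using h.symm
  · have hR : CFC.sqrt G (CFC.sqrt G v) = g • v := by
      rw [← hv]
      conv_rhs => rw [← CFC.sqrt_mul_sqrt_self G hG]
      rfl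
    set y := CFC.sqrt G v - √g • v with hy
    have hRy : CFC.sqrt G y = (-√g) • y := by
      rw [hy, map_sub, hR, ContinuousLinearMap.map_smul_of_tower, neg_smul, smul_sub, smul_smul,
        Real.mul_self_sqrt hg.le]
      abel
    have h := qf_nonneg (CFC.sqrt_nonneg G) y
    rw [qf_eq_of_eigenvector hRy] at h
    have hs : 0 < √g := Real.sqrt_pos.2 hg
    have : ‖y‖ ^ 2 = 0 := le_antisymm (by nlinarith) (by positivity)
    simpa using this

theorem trMul_of_eigenbasis {ι : Type*} (b : HilbertBasis ι ℂ E) {A G : E →L[ℂ] E} (hA : 0 ≤ A)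
    (hG : 0 ≤ G) {g : ι → ℝ} (hg : ∀ i, 0 ≤ g i) (h : ∀ i, G (b i) = g i • b i) :
    trMul A G = ∑' i, ENNReal.ofReal (g i * qf A (b i)) := by
  rw [trMul_eq_tsum b hA]
  refine tsum_congr fun i => ?_
  rw [sqrt_apply_of_eigenvector hG (hg i) (h i), qf, ← Complex.coe_smul, map_smul,
    inner_smul_left, inner_smul_right, Complex.conj_ofReal, ← mul_assoc, ← Complex.ofReal_mul,
    Real.mul_self_sqrt (hg i), Complex.re_ofReal_mul, qf]

theorem exists_nonneg_of_eigenbasis {ι : Type*} (b : HilbertBasis ι ℂ E) {t : ι → ℝ}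
    (ht : ∀ i, 0 ≤ t i) (hs : Summable t) :
    ∃ T : E →L[ℂ] E, 0 ≤ T ∧ ∀ i, T (b i) = t i • b i := by
  have hsum : Summable fun i => t i • InnerProductSpace.rankOne ℂ (b i) (b i) := by
    refine Summable.of_norm_bounded hs fun i => ?_
    rw [norm_smul, InnerProductSpace.norm_rankOne, b.orthonormal.norm_eq_one]
    simp [abs_of_nonneg (ht i)]
  refine ⟨∑' i, t i • InnerProductSpace.rankOne ℂ (b i) (b i),
    tsum_nonneg fun i => smul_nonneg (ht i) ((ContinuousLinearMap.nonneg_iff_isPositive _).2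
      (InnerProductSpace.isPositive_rankOne_self (b i))), fun i => ?_⟩
  have h := (ContinuousLinearMap.apply ℂ E (b i)).hasSum hsum.hasSum
  have h' := hasSum_single (f := fun j => (ContinuousLinearMap.apply ℂ E (b i))
    (t j • InnerProductSpace.rankOne ℂ (b j) (b j))) i fun j hj => by
      simp [InnerProductSpace.rankOne_apply, b.orthonormal.2 hj]
  rw [ContinuousLinearMap.apply_apply] at h
  rw [h.unique h']
  simp [InnerProductSpace.rankOne_apply, b.orthonormal.norm_eq_one]

theorem exists_trMul_negLogOp_le {A : E →L[ℂ] E} (hA : A ∈ subStates E) {c : ℝ≥0∞}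
    (hc : qEntropy A < c) :
    ∃ T ∈ subStates E, ∀ ε : ℝ, 0 < ε → trMul A (negLogOp ε T) ≤ c := by
  obtain ⟨s, hs⟩ := iInf_lt_iff.1 hc
  obtain ⟨hs, hlt⟩ := iInf_lt_iff.1 hs
  set b := hs.hilbertBasis
  have hb : ∀ v : s, b v = v := hs.hilbertBasis_apply
  set a : s → ℝ := fun v => qf A v with ha
  have ha0 : ∀ v, 0 ≤ a v := fun v => qf_nonneg hA.1 _
  have hsum : Summable a := by
    have h : ∑' v, ENNReal.ofReal (a v) ≠ ∞ := by
      refine ne_top_of_le_ne_top ENNReal.one_ne_top (le_of_eq_of_le ?_ hA.2)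
      rw [traceENN_eq_tsum b hA.1]
      simp only [hb, ha]
    simpa [ENNReal.toReal_ofReal (ha0 _)] using ENNReal.summable_toReal h
  set S := ∑' v, a v with hS
  have hS0 : 0 ≤ S := tsum_nonneg ha0
  have ht0 : ∀ v, 0 ≤ a v / S := fun v => div_nonneg (ha0 v) hS0
  have hts : Summable fun v => a v / S := hsum.div_const S
  have ht1 : ∀ v, a v / S ≤ 1 := fun v =>
    div_le_one_of_le₀ (hsum.le_tsum v fun j _ => ha0 j) hS0
  obtain ⟨T, hT0, hT⟩ := exists_nonneg_of_eigenbasis b ht0 hts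
  have hTK : T ∈ subStates E := by
    refine ⟨hT0, ?_⟩
    simp only [traceENN_eq_tsum b hT0, qf_eq_of_eigenvector (hT _), b.orthonormal.norm_eq_one,
      one_pow, mul_one]
    rw [← ENNReal.ofReal_tsum_of_nonneg ht0 hts, tsum_div_const]
    exact ENNReal.ofReal_le_one.2 (div_self_le_one S)
  refine ⟨T, hTK, fun ε hε => le_trans ?_ hlt.le⟩
  have hg : ∀ v, 0 ≤ Real.log (1 + ε) - Real.log (a v / S + ε) := fun v => by
    have := ht0 v
    exact sub_nonneg.2 (Real.log_le_log (by positivity) (by linarith [ht1 v]))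
  rw [trMul_of_eigenbasis b hA.1 (negLogOp_nonneg hε hTK) hg fun v =>
    negLogOp_apply_of_eigenvector hε hT0 (ht0 v) (hT v), clEntropy, ← ENNReal.tsum_mul_left]
  refine ENNReal.tsum_le_tsum fun v => ?_
  rw [← ENNReal.ofReal_mul hS0]
  refine ENNReal.ofReal_le_ofReal ?_
  rw [hb]
  change _ * a v ≤ S * Real.negMulLog (a v / S)
  rcases (ha0 v).eq_or_lt with h0 | h0
  · simp [← h0]
  have hSpos : 0 < S := h0.trans_le (hsum.le_tsum v fun j _ => ha0 j)
  have htpos : 0 < a v / S := div_pos h0 hSpos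
  have hSt : S * (a v / S) = a v := by field_simp
  have hlog : Real.log (1 + ε) + Real.log (a v / S) ≤ Real.log (a v / S + ε) := by
    rw [← Real.log_mul (by positivity) htpos.ne']
    exact Real.log_le_log (by positivity) (by nlinarith [ht1 v])
  calc _ ≤ -Real.log (a v / S) * a v := by gcongr; linarith
    _ = -Real.log (a v / S) * (S * (a v / S)) := by rw [hSt]
    _ = S * Real.negMulLog (a v / S) := by rw [Real.negMulLog]; ring

end Diagonal

section Bounds

variable {E : Type*} [NormedAddCommGroup E] [InnerProductSpace ℂ E] [CompleteSpace E]

theorem trMul_negLogOp_ne_top {ε : ℝ} (hε : 0 < ε) {A T : E →L[ℂ] E} (hA : A ∈ subStates E)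
    (hT : T ∈ subStates E) : trMul A (negLogOp ε T) ≠ ∞ := by
  have hlog : 0 ≤ Real.log (1 + ε) - Real.log ε :=
    sub_nonneg.2 (Real.log_le_log hε (by linarith))
  refine ne_top_of_le_ne_top ?_
    (trMul_mono_right A (negLogOp_nonneg hε hT) (negLogOp_le hε hT.1))
  rw [trMul_smul_right A zero_le_one hlog, trMul_one_right hA.1]
  exact ENNReal.mul_ne_top ENNReal.ofReal_ne_top (ne_top_of_le_ne_top ENNReal.one_ne_top hA.2)

theorem convexOn_trMul_negLogOp {ε : ℝ} (hε : 0 < ε) {A : E →L[ℂ] E} (hA : A ∈ subStates E) :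
    ConvexOn ℝ (subStates E) fun T => (trMul A (negLogOp ε T)).toReal := by
  refine ⟨convex_subStates, fun X hX Y hY a b ha hb hab => ?_⟩
  have hm := convex_subStates hX hY ha hb hab
  have hX0 := negLogOp_nonneg hε hX
  have hY0 := negLogOp_nonneg hε hY
  have hXt := trMul_negLogOp_ne_top hε hA hX
  have hYt := trMul_negLogOp_ne_top hε hA hY
  have h := trMul_mono_right A (negLogOp_nonneg hε hm)
    ((convexOn_negLogOp hε).2 hX hY ha hb hab)
  rw [trMul_add_right A (smul_nonneg ha hX0) (smul_nonneg hb hY0), trMul_smul_right A hX0 ha,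
    trMul_smul_right A hY0 hb] at h
  have h' := ENNReal.toReal_mono (by finiteness) h
  rwa [ENNReal.toReal_add (by finiteness) (by finiteness), ENNReal.toReal_mul,
    ENNReal.toReal_mul, ENNReal.toReal_ofReal ha, ENNReal.toReal_ofReal hb] at h'

theorem isClosed_trMul_negLogOp_le {ε : ℝ} (hε : 0 < ε) (A : E →L[ℂ] E) (c : ℝ≥0∞) :
    IsClosed (subStates E ∩ {T | trMul A (negLogOp ε T) ≤ c}) := by
  have h := (continuousOn_negLogOp (E := E) hε).preimage_isClosed_of_isClosed
    isClosed_subStates (isClosed_trMul_le A c)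
  convert! h using 1
  ext T
  simp only [Set.mem_inter_iff, Set.mem_preimage, Set.mem_ofPred_eq]
  refine and_congr_right fun hT => ?_
  rw [trMul_eq_tsum' (stdBasis E) A (negLogOp_nonneg hε hT)]

theorem exists_forall_trMul_negLogOp_lt {𝒜 : Set (E →L[ℂ] E)} (hconv : Convex ℝ 𝒜)
    (h𝒜 : 𝒜 ⊆ subStates E) {c d : ℝ} (hc : 0 ≤ c) (hcd : c < d)
    (hbdd : ∀ A ∈ 𝒜, qEntropy A < ENNReal.ofReal c) {ε : ℝ} (hε : 0 < ε) {ι : Type*} [Fintype ι]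
    (A : ι → E →L[ℂ] E) (hA : ∀ i, A i ∈ 𝒜) :
    ∃ T ∈ subStates E, ∀ i, (trMul (A i) (negLogOp ε T)).toReal < d := by
  have hne : (subStates E).Nonempty := ⟨0, zero_mem_subStates⟩
  refine exists_forall_lt_of_convexOn (V := E →L[ℂ] E) (K := subStates E)
    (f := fun i T => (trMul (A i) (negLogOp ε T)).toReal)
    convex_subStates hne (fun i => convexOn_trMul_negLogOp hε (h𝒜 (hA i))) hcd
    fun p hp hp1 => ?_
  have hΩ : ∑ i, p i • A i ∈ 𝒜 := hconv.sum_mem (fun i _ => hp i) hp1 fun i _ => hA i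
  obtain ⟨T, hT, hTc⟩ := exists_trMul_negLogOp_le (h𝒜 hΩ) (hbdd _ hΩ)
  refine ⟨T, hT, ?_⟩
  have h := hTc ε hε
  rw [trMul_sum_smul_left _ (fun i _ => (h𝒜 (hA i)).1) (fun i _ => hp i)] at h
  have h' := ENNReal.toReal_mono ENNReal.ofReal_ne_top h
  rw [ENNReal.toReal_ofReal hc, ENNReal.toReal_sum fun i _ => ENNReal.mul_ne_top
    ENNReal.ofReal_ne_top (trMul_negLogOp_ne_top hε (h𝒜 (hA i)) hT)] at h'
  simpa only [ENNReal.toReal_mul, ENNReal.toReal_ofReal (hp _)] using h'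

theorem exists_unique_minimal {𝒜 : Set (E →L[ℂ] E)} (hconv : Convex ℝ 𝒜)
    (h𝒜 : 𝒜 ⊆ subStates E) {c d : ℝ} (hc : 0 ≤ c) (hcd : c < d)
    (hbdd : ∀ A ∈ 𝒜, qEntropy A < ENNReal.ofReal c) :
    ∃ T ∈ subStates E, (∀ A ∈ 𝒜, ∀ n : ℕ,
        trMul A (negLogOp (1 / (n + 1 : ℝ)) T) ≤ ENNReal.ofReal d) ∧
      ∀ S ∈ subStates E, (∀ A ∈ 𝒜, ∀ n : ℕ,
        trMul A (negLogOp (1 / (n + 1 : ℝ)) S) ≤ ENNReal.ofReal d) →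
        hsSq S = hsSq T → S = T := by
  have hε : ∀ n : ℕ, (0 : ℝ) < 1 / (n + 1 : ℝ) := fun n => Nat.one_div_pos_of_nat
  have htop : ∀ X ∈ subStates E, hsSq X ≠ ∞ := fun X hX =>
    ne_top_of_le_ne_top ENNReal.one_ne_top (hsSq_le_one hX)
  let F : 𝒜 × ℕ → Set (E →L[ℂ] E) := fun i =>
    {T | trMul i.1 (negLogOp (1 / (i.2 + 1 : ℝ)) T) ≤ ENNReal.ofReal d}
  have hFiff : ∀ (i : 𝒜 × ℕ), ∀ X ∈ subStates E, X ∈ F i ↔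
      (trMul i.1 (negLogOp (1 / (i.2 + 1 : ℝ)) X)).toReal ≤ d := fun i X hX =>
    ENNReal.le_ofReal_iff_toReal_le (trMul_negLogOp_ne_top (hε _) (h𝒜 i.1.2) hX)
      (hc.trans hcd.le)
  have hFclosed : ∀ i, IsClosed (subStates E ∩ F i) := fun i =>
    isClosed_trMul_negLogOp_le (hε i.2) (i.1 : E →L[ℂ] E) (ENNReal.ofReal d)
  have hFconvex : ∀ i, Convex ℝ (subStates E ∩ F i) := fun i => by
    convert! (convexOn_trMul_negLogOp (hε i.2) (h𝒜 i.1.2)).convex_le d using 1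
    ext X
    exact and_congr_right fun hX => hFiff i X hX
  have hclosed : ∀ r : ℝ, IsClosed {X | X ∈ subStates E ∧ (hsSq X).toReal ≤ r} := fun r => by
    rcases lt_or_ge r 0 with hr | hr
    · convert! isClosed_empty
      ext X
      simpa using fun _ => hr.trans_le ENNReal.toReal_nonneg
    · convert! isClosed_subStates.inter (isClosed_hsSq_le (E := E) (ENNReal.ofReal r)) using 1
      ext X
      exact and_congr_right fun hX => (ENNReal.le_ofReal_iff_toReal_le (htop X hX) hr).symm
  have hne : ∀ s : Finset (𝒜 × ℕ), ∃ X ∈ subStates E, ∀ i ∈ s, X ∈ F i := fun s => by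
    obtain ⟨X, hX, hlt⟩ := exists_forall_trMul_negLogOp_lt hconv h𝒜 hc hcd hbdd
      (hε (s.sup Prod.snd)) (fun i : s => (i.1.1 : E →L[ℂ] E)) fun i => i.1.1.2
    refine ⟨X, hX, fun i hi => (hFiff i X hX).2 (le_trans ?_ (hlt ⟨i, hi⟩).le)⟩
    refine ENNReal.toReal_mono (trMul_negLogOp_ne_top (hε _) (h𝒜 i.1.2) hX)
      (trMul_mono_right _ (negLogOp_nonneg (hε _) hX) (negLogOp_anti (hε _) ?_ hX))
    have : i.2 ≤ s.sup Prod.snd := Finset.le_sup hi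
    exact one_div_le_one_div_of_le (by positivity) (by gcongr)
  obtain ⟨T, hT, hTF, huniq⟩ := exists_unique_minimizer (V := E →L[ℂ] E) (K := subStates E)
    (q := fun X => (hsSq X).toReal) (F := F) (fun _ _ => ENNReal.toReal_nonneg)
    (fun X hX => ENNReal.toReal_le_of_le_ofReal zero_le_one (by simpa using hsSq_le_one hX))
    hclosed (fun X hX Y hY => norm_sub_sq_le_hsSq (htop X hX) (htop Y hY))
    convex_subStates hFclosed hFconvex hne
  exact ⟨T, hT, fun A hA n => hTF (⟨A, hA⟩, n), fun S hS hSF hle => huniq S hS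
    (fun i => hSF i.1 i.1.2 i.2) (by rw [hle])⟩

theorem traceNegLog_le {A T : E →L[ℂ] E} (hA : A ∈ subStates E) (hT : T ∈ subStates E)
    {c : ℝ≥0∞} (h : ∀ n : ℕ, trMul A (negLogOp (1 / (n + 1 : ℝ)) T) ≤ c) :
    traceNegLog A T ≤ c := by
  refine iSup_le fun n => ?_
  have h0 : 0 ≤ cfc (fun x : ℝ => max 0 (-(Real.log (x + 1 / (n + 1 : ℝ))))) T :=
    cfc_nonneg fun x _ => le_max_left _ _
  exact (ofReal_re_traceC_mul_le hA.1 (ne_top_of_le_ne_top ENNReal.one_ne_top hA.2) h0).trans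
    ((trMul_mono_right A h0 (cfc_max_neg_log_le Nat.one_div_pos_of_nat hT)).trans (h n))

end Bounds

/-- Lemma 1 of the paper. If `𝒜` is a convex subset of `𝔗₁(ℋ)` on
which the quantum entropy is bounded, then there is an operator `T ∈ 𝔗₁(ℋ)` with
`sup_{A ∈ 𝒜} Tr A(−log T) < ∞` which commutes with every unitary `U` such that
`U 𝒜 U* ⊆ 𝒜`. -/
theorem statement1
    {E : Type*} [NormedAddCommGroup E] [InnerProductSpace ℂ E] [CompleteSpace E]
    [TopologicalSpace.SeparableSpace E]
    (𝒜 : Set (E →L[ℂ] E)) (hconv : Convex ℝ 𝒜)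
    (h𝒜 : ∀ A ∈ 𝒜, A.IsPositive ∧ traceENN A ≤ 1)
    (hbdd : ∃ C : ℝ, ∀ A ∈ 𝒜, qEntropy A ≤ ENNReal.ofReal C) :
    ∃ T : E →L[ℂ] E, T.IsPositive ∧ traceENN T ≤ 1 ∧
      (∃ C : ℝ, ∀ A ∈ 𝒜, traceNegLog A T ≤ ENNReal.ofReal C) ∧
      ∀ U : E →L[ℂ] E, U ∈ unitary (E →L[ℂ] E) →
        (∀ A ∈ 𝒜, U * A * star U ∈ 𝒜) → U * T = T * U := by
  obtain ⟨C, hC⟩ := hbdd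
  have hsub : 𝒜 ⊆ subStates E := fun A hA =>
    ⟨(ContinuousLinearMap.nonneg_iff_isPositive A).2 (h𝒜 A hA).1, (h𝒜 A hA).2⟩
  have hc : 0 < |C| + 1 := by positivity
  have hC' : ∀ A ∈ 𝒜, qEntropy A < ENNReal.ofReal (|C| + 1) := fun A hA =>
    (hC A hA).trans_lt ((ENNReal.ofReal_lt_ofReal_iff hc).2 (by linarith [le_abs_self C]))
  obtain ⟨T, hT, hTle, huniq⟩ :=
    exists_unique_minimal hconv hsub hc.le (lt_add_one (|C| + 1)) hC'
  refine ⟨T, (ContinuousLinearMap.nonneg_iff_isPositive T).1 hT.1, hT.2,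
    ⟨_, fun A hA => traceNegLog_le (hsub hA) hT (hTle A hA)⟩, fun U hU hU𝒜 => ?_⟩
  have hconj : star U * T * U = T := by
    refine huniq _ (conj_mem_subStates hU hT) (fun A hA n => ?_) (hsSq_conj hU T)
    have hn : (0 : ℝ) < 1 / (n + 1 : ℝ) := Nat.one_div_pos_of_nat
    rw [negLogOp_conj hn hU hT.1, ← trMul_conj U (hsub hA).1 (negLogOp_nonneg hn hT)]
    exact hTle _ (hU𝒜 A hA) n
  calc U * T = U * (star U * T * U) := by rw [hconj]
    _ = (U * star U) * (T * U) := by simp only [mul_assoc]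
    _ = T * U := by rw [Unitary.mul_star_self_of_mem hU, one_mul]

end QIT
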